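/- arXiv:1512.09045 — 4 statements merged into one kernel-verified Lean document; each statement's English description precedes it below -/
import Mathlib

section
/- Let f : {−1,1}^m → {−1,1} be a Boolean function, let I₁, …, I_n be a partition of {1,…,m}, and for each j let f_j = ∑_{∅ ≠ S ⊆ I_j} f̂(S)·χ_S be the restriction of f to the subset I_j. Let ε ≥ 0 and suppose that f is concentrated on Fourier coefficients that do not cross the partition: ∑_{S : ∃ j, S ⊆ I_j} f̂(S)² ≥ 1 − ε · Var f. Then there exists k ∈ {1,…,n} such that ‖f − f_k − f̂(∅)‖₂² ≤ 61442 · ε. -/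
open Finset

/-- The sign `±1 : ℝ` associated to a bit (`true ↦ 1`, `false ↦ -1`). -/
def toSign (b : Bool) : ℝ := if b then 1 else -1

/-- The character `χ_S(x) = ∏_{i ∈ S} x_i` on the Boolean cube. -/
def chi {m : ℕ} (S : Finset (Fin m)) (x : Fin m → Bool) : ℝ := ∏ i ∈ S, toSign (x i)

/-- Expectation of `g` under the uniform distribution on `{−1,1}^m`. -/
noncomputable def expect {m : ℕ} (g : (Fin m → Bool) → ℝ) : ℝ :=
  (∑ x : Fin m → Bool, g x) / 2 ^ m

/-- The Fourier coefficient `f̂(S) = E_x[f(x)·χ_S(x)]`. -/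
noncomputable def coeff {m : ℕ} (f : (Fin m → Bool) → ℝ) (S : Finset (Fin m)) : ℝ :=
  expect (fun x => f x * chi S x)

section Expectation

variable {m : ℕ}

lemma cube_expect_add (g h : (Fin m → Bool) → ℝ) :
    expect (fun x => g x + h x) = expect g + expect h := by
  simp only [_root_.expect, sum_add_distrib, add_div]

lemma cube_expect_sub (g h : (Fin m → Bool) → ℝ) :
    expect (fun x => g x - h x) = expect g - expect h := by
  simp only [_root_.expect, sum_sub_distrib, sub_div]

lemma cube_expect_const_mul (c : ℝ) (g : (Fin m → Bool) → ℝ) :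
    expect (fun x => c * g x) = c * expect g := by
  simp only [_root_.expect, ← mul_sum, mul_div_assoc]

lemma cube_expect_const (c : ℝ) : expect (fun _ : Fin m → Bool => c) = c := by
  simp [_root_.expect]

lemma cube_expect_sum {ι : Type*} (s : Finset ι) (g : ι → (Fin m → Bool) → ℝ) :
    expect (fun x => ∑ i ∈ s, g i x) = ∑ i ∈ s, expect (g i) := by
  simp only [_root_.expect, sum_div]
  exact sum_comm

lemma cube_expect_mono {g h : (Fin m → Bool) → ℝ} (H : ∀ x, g x ≤ h x) : expect g ≤ expect h := by
  unfold _root_.expect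
  gcongr
  exact H _

lemma cube_expect_comm (g : (Fin m → Bool) → (Fin m → Bool) → ℝ) :
    expect (fun x => expect (g x)) = expect (fun y => expect (fun x => g x y)) := by
  simp only [_root_.expect, ← sum_div]
  rw [sum_comm]

end Expectation

section Fourier

variable {m : ℕ}

lemma toSign_mul_self (b : Bool) : toSign b * toSign b = 1 := by
  cases b <;> simp [toSign]

lemma expect_chi (S : Finset (Fin m)) : expect (chi S) = if S = ∅ then 1 else 0 := by
  have key : ∑ x : Fin m → Bool, chi S x
      = ∏ i : Fin m, ∑ b : Bool, if i ∈ S then toSign b else 1 := by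
    rw [prod_univ_sum]
    rw [Fintype.piFinset_univ]
    simp only [chi, prod_ite_mem, univ_inter]
  unfold _root_.expect
  rw [key]
  split_ifs with h
  · simp [h]
  · obtain ⟨i, hi⟩ := nonempty_iff_ne_empty.mpr h
    rw [prod_eq_zero (mem_univ i) (by simp [hi, toSign]), zero_div]

lemma chi_mul_chi (S T : Finset (Fin m)) (x : Fin m → Bool) :
    chi S x * chi T x = chi (symmDiff S T) x := by
  have h (U : Finset (Fin m)) : chi U x = ∏ i, if i ∈ U then toSign (x i) else 1 := by
    simp [chi, prod_ite_mem]
  rw [h, h, h, ← prod_mul_distrib]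
  refine prod_congr rfl fun i _ => ?_
  have := toSign_mul_self (x i)
  by_cases hS : i ∈ S <;> by_cases hT : i ∈ T <;> simp [hS, hT, mem_symmDiff, this]

lemma expect_chi_mul_chi (S T : Finset (Fin m)) :
    expect (fun x => chi S x * chi T x) = if S = T then 1 else 0 := by
  simp only [chi_mul_chi]
  rw [show (fun x => chi (symmDiff S T) x) = chi (symmDiff S T) from rfl, expect_chi]
  simp [← bot_eq_empty]

lemma sum_chi_mul_chi (x y : Fin m → Bool) :
    ∑ S : Finset (Fin m), chi S x * chi S y = if x = y then 2 ^ m else 0 := by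
  have h := prod_one_add (f := fun i => toSign (x i) * toSign (y i)) (univ : Finset (Fin m))
  simp only [chi, ← prod_mul_distrib, powerset_univ] at h ⊢
  rw [← h]
  split_ifs with hxy
  · subst hxy
    simp only [toSign_mul_self]
    norm_num
  · obtain ⟨i, hi⟩ := Function.ne_iff.mp hxy
    refine prod_eq_zero (mem_univ i) ?_
    cases hx : x i <;> cases hy : y i <;> simp_all [toSign]

lemma sum_coeff_mul_chi (f : (Fin m → Bool) → ℝ) (y : Fin m → Bool) :
    ∑ S, coeff f S * chi S y = f y := by
  have h1 (S : Finset (Fin m)) :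
      coeff f S * chi S y = expect (fun x => f x * (chi S x * chi S y)) := by
    rw [coeff, mul_comm, ← cube_expect_const_mul]
    congr 1
    ext x
    ring
  simp only [h1]
  rw [← cube_expect_sum]
  simp only [← mul_sum, sum_chi_mul_chi]
  simp [_root_.expect]

lemma expect_sq_sum_chi (c : Finset (Fin m) → ℝ) :
    expect (fun x => (∑ S, c S * chi S x) ^ 2) = ∑ S, c S ^ 2 := by
  have h (x : Fin m → Bool) : (∑ S, c S * chi S x) ^ 2
      = ∑ S, ∑ T, c S * c T * (chi S x * chi T x) := by
    rw [sq, sum_mul_sum]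
    refine sum_congr rfl fun S _ => sum_congr rfl fun T _ => ?_
    ring
  simp only [h]
  rw [cube_expect_sum]
  refine sum_congr rfl fun S _ => ?_
  rw [cube_expect_sum]
  simp only [cube_expect_const_mul, expect_chi_mul_chi]
  simp [sq]

lemma expect_sum_chi (c : Finset (Fin m) → ℝ) :
    expect (fun x => ∑ S, c S * chi S x) = c ∅ := by
  rw [cube_expect_sum]
  simp only [cube_expect_const_mul]
  simp [expect_chi]

lemma chi_piecewise (A S : Finset (Fin m)) (x y : Fin m → Bool) :
    chi S (A.piecewise x y) = chi (S ∩ A) x * chi (S \ A) y := by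
  unfold chi
  rw [← prod_inter_mul_prod_sdiff S A]
  congr 1
  · refine prod_congr rfl fun i hi => ?_
    rw [piecewise_eq_of_mem _ _ _ (mem_inter.mp hi).2]
  · refine prod_congr rfl fun i hi => ?_
    rw [piecewise_eq_of_notMem _ _ _ (mem_sdiff.mp hi).2]

/-- Averaging over the coordinates in `A` keeps exactly the coefficients disjoint from `A`. -/
lemma expect_piecewise (f : (Fin m → Bool) → ℝ) (A : Finset (Fin m)) (y : Fin m → Bool) :
    expect (fun x => f (A.piecewise x y))
      = ∑ S, (if Disjoint S A then coeff f S else 0) * chi S y := by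
  simp only [← sum_coeff_mul_chi f (A.piecewise _ y)]
  rw [cube_expect_sum]
  refine sum_congr rfl fun S _ => ?_
  rw [cube_expect_const_mul]
  simp only [chi_piecewise, mul_comm (chi (S ∩ A) _), cube_expect_const_mul]
  rw [show expect (fun x => chi (S ∩ A) x) = _ from expect_chi (S ∩ A)]
  by_cases h : Disjoint S A
  · simp [h, disjoint_iff_inter_eq_empty.mp h, sdiff_eq_self_of_disjoint h]
  · simp [h, mt disjoint_iff_inter_eq_empty.mpr h]

lemma sum_coeff_sq_eq_one {f : (Fin m → Bool) → ℝ} (hf : ∀ x, f x = 1 ∨ f x = -1) :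
    ∑ S, coeff f S ^ 2 = 1 := by
  rw [← expect_sq_sum_chi]
  have hsq (x : Fin m → Bool) : f x ^ 2 = 1 := by rcases hf x with h | h <;> norm_num [h]
  simp only [sum_coeff_mul_chi, hsq, cube_expect_const]

end Fourier

section Boolean

variable {m : ℕ}

/-- If the difference of two sign vectors has small variance, then either their means are close or
the first one is almost constant. -/
lemma variance_mul_sq_mean_sub_le {u v : (Fin m → Bool) → ℝ} (hu : ∀ x, u x = 1 ∨ u x = -1)
    (hv : ∀ x, v x = 1 ∨ v x = -1) :
    (1 - expect u ^ 2) * (expect u - expect v) ^ 2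
      ≤ 4 * (2 - 2 * expect (fun x => u x * v x) - (expect u - expect v) ^ 2) := by
  set c := expect (fun x => u x * v x) with hc
  have hbound (s t : ℝ) (hs : s = 1 ∨ s = -1) (ht : t = 1 ∨ t = -1) :
      0 ≤ 1 + s * expect u + t * expect v + s * t * c := by
    have h : expect (fun x => (1 + s * u x) + t * v x + s * t * (u x * v x))
        = 1 + s * expect u + t * expect v + s * t * c := by
      simp only [cube_expect_add, cube_expect_const_mul, cube_expect_const, hc]
    rw [← h, ← cube_expect_const (m := m) 0]
    refine cube_expect_mono fun x => ?_
    rcases hu x with h1 | h1 <;> rcases hv x with h2 | h2 <;> rcases hs with rfl | rfl <;>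
      rcases ht with rfl | rfl <;> norm_num [h1, h2]
  have h1 := hbound 1 1 (by simp) (by simp)
  have h2 := hbound 1 (-1) (by simp) (by simp)
  have h3 := hbound (-1) 1 (by simp) (by simp)
  have h4 := hbound (-1) (-1) (by simp) (by simp)
  generalize expect u = p at *
  generalize expect v = q at *
  have key (p q c : ℝ) (hp : p ≤ 1) (hq : -1 ≤ q) (hqp : q ≤ p) (hcc : c ≤ 1 - (p - q)) :
      (1 - p ^ 2) * (p - q) ^ 2 ≤ 4 * (2 - 2 * c - (p - q) ^ 2) := by
    have e1 : (1 - p ^ 2) * (p - q) ≤ 4 * (2 - (p - q)) := by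
      nlinarith [mul_nonneg (sub_nonneg.2 hp) (sub_nonneg.2 hp), sq_nonneg (1 + p)]
    nlinarith [mul_le_mul_of_nonneg_left e1 (sub_nonneg.2 hqp)]
  rcases le_total q p with h | h
  · exact key p q c (by linarith) (by linarith) h (by linarith)
  · have := key (-p) (-q) c (by linarith) (by linarith) (by linarith) (by linarith)
    nlinarith

/-- A sign matrix that is almost a sum of a function of the row and a function of the column
almost depends on only one of them. -/
lemma variance_mul_variance_le {F : (Fin m → Bool) → (Fin m → Bool) → ℝ}
    (hF : ∀ x y, F x y = 1 ∨ F x y = -1) {a M N : ℝ}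
    (ha : expect (fun y => expect (fun x => F x y)) = a)
    (hM : expect (fun y => expect (fun x => F x y) ^ 2) = M)
    (hN : expect (fun x => expect (fun y => F x y) ^ 2) = N) :
    (1 - M) * (M - a ^ 2) ≤ 8 * (1 - N - M + a ^ 2) := by
  set μ := fun y => expect (fun x => F x y) with hμ
  set ν := fun x => expect (fun y => F x y) with hν
  have hν1 : expect (fun y => expect (fun x => F x y * ν x)) = N := by
    rw [← cube_expect_comm fun x y => F x y * ν x, ← hN]
    congr 1
    ext x
    simp only [mul_comm _ (ν x), cube_expect_const_mul]
    rw [sq]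
  have hpt (y : Fin m → Bool) :
      (1 - μ y ^ 2) * (M - a ^ 2)
        ≤ 4 * (2 - 2 * expect (fun x => F x y * ν x) - μ y ^ 2 + 2 * a * μ y - M) := by
    have hμ1 : μ y ^ 2 ≤ 1 := by
      have h1 : μ y ≤ 1 := by
        rw [← cube_expect_const (m := m) 1]
        exact cube_expect_mono fun x => by rcases hF x y with h | h <;> norm_num [h]
      have h2 : -1 ≤ μ y := by
        rw [← cube_expect_const (m := m) (-1)]
        exact cube_expect_mono fun x => by rcases hF x y with h | h <;> norm_num [h]
      nlinarith
    have h := cube_expect_mono fun y' =>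
      variance_mul_sq_mean_sub_le (fun x => hF x y) (fun x => hF x y')
    have hsq : expect (fun y' => (μ y - μ y') ^ 2) = μ y ^ 2 - 2 * a * μ y + M := by
      simp only [sub_sq, cube_expect_add, cube_expect_sub, cube_expect_const_mul, cube_expect_const]
      rw [ha, hM]
      ring
    have hcov : expect (fun y' => expect (fun x => F x y * F x y'))
        = expect (fun x => F x y * ν x) := by
      rw [← cube_expect_comm fun x y' => F x y * F x y']
      simp only [cube_expect_const_mul, hν]
    simp only [cube_expect_sub, cube_expect_const_mul, cube_expect_const] at h
    rw [hcov] at h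
    change (1 - μ y ^ 2) * expect (fun y' => (μ y - μ y') ^ 2)
      ≤ 4 * (2 - 2 * _ - expect (fun y' => (μ y - μ y') ^ 2)) at h
    rw [hsq] at h
    nlinarith [mul_nonneg (sub_nonneg.2 hμ1) (sq_nonneg (μ y - a))]
  have h := cube_expect_mono hpt
  simp only [mul_comm _ (M - a ^ 2), cube_expect_sub, cube_expect_add, cube_expect_const_mul,
    cube_expect_const] at h
  change (M - a ^ 2) * (1 - expect (fun y => μ y ^ 2)) ≤ 4 * (2 - 2 * _
    - expect (fun y => μ y ^ 2) + 2 * a * expect (fun y => μ y) - M) at h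
  rw [hν1, hM, show expect (fun y => μ y) = a from ha] at h
  linarith

/-- For a Boolean function, the Fourier weights inside `A` and inside its complement cannot both be
large unless the weight crossing between the two is. -/
lemma weight_mul_weight_compl_le {f : (Fin m → Bool) → ℝ} (hf : ∀ x, f x = 1 ∨ f x = -1)
    (A : Finset (Fin m)) :
    (∑ S ∈ A.powerset.erase ∅, coeff f S ^ 2) * (∑ S ∈ Aᶜ.powerset.erase ∅, coeff f S ^ 2)
      ≤ 8 * (1 - coeff f ∅ ^ 2 - ∑ S ∈ A.powerset.erase ∅, coeff f S ^ 2
        - ∑ S ∈ Aᶜ.powerset.erase ∅, coeff f S ^ 2) := by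
  have hmean : expect (fun y => expect (fun x => f (A.piecewise x y))) = coeff f ∅ := by
    simp only [expect_piecewise, expect_sum_chi]
    simp
  have hsq (B : Finset (Fin m)) : expect (fun y => expect (fun x => f (B.piecewise x y)) ^ 2)
      = coeff f ∅ ^ 2 + ∑ S ∈ Bᶜ.powerset.erase ∅, coeff f S ^ 2 := by
    simp only [expect_piecewise, expect_sq_sum_chi]
    rw [add_sum_erase _ (fun S => coeff f S ^ 2) (empty_mem_powerset _)]
    simp only [ite_pow, ne_eq, OfNat.ofNat_ne_zero, not_false_eq_true, zero_pow, ← sum_filter]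
    refine sum_congr ?_ fun _ _ => rfl
    ext S
    simp [subset_compl_iff_disjoint_right]
  have hsq' := hsq Aᶜ
  simp only [piecewise_compl, compl_compl] at hsq'
  have h := variance_mul_variance_le (fun x y => hf (A.piecewise x y)) hmean (hsq A) hsq'
  have hle : coeff f ∅ ^ 2 + ∑ S ∈ Aᶜ.powerset.erase ∅, coeff f S ^ 2 ≤ 1 := by
    rw [add_sum_erase _ (fun S => coeff f S ^ 2) (empty_mem_powerset _), ← sum_coeff_sq_eq_one hf]
    exact sum_le_univ_sum_of_nonneg fun _ => sq_nonneg _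
  have hW : 0 ≤ ∑ S ∈ Aᶜ.powerset.erase ∅, coeff f S ^ 2 := sum_nonneg fun _ _ => sq_nonneg _
  have hcross := mul_nonneg (sub_nonneg.2 hle) hW
  nlinarith

end Boolean

lemma sum_ite_mem_zero {ι : Type*} [Fintype ι] [DecidableEq ι] (P : Finset ι) (g : ι → ℝ) :
    ∑ j, (if j ∈ P then 0 else g j) = ∑ j ∈ Pᶜ, g j := by
  rw [sum_ite, sum_const_zero, zero_add]
  congr 1
  ext j
  simp

/-- Among weights bounded by `c`, some subset has total weight within a factor `2` of `c`. -/
lemma exists_subset_sum_mem_Icc {ι : Type*} [DecidableEq ι] (w : ι → ℝ) {c : ℝ}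
    (s : Finset ι) (hw : ∀ j ∈ s, w j ≤ c) (hs : c ≤ ∑ j ∈ s, w j) (hc : 0 ≤ c) :
    ∃ A ⊆ s, c ≤ ∑ j ∈ A, w j ∧ ∑ j ∈ A, w j ≤ 2 * c := by
  induction s using Finset.induction_on with
  | empty => exact ⟨∅, subset_rfl, hs, by simpa using hc⟩
  | insert k s hk ih =>
    by_cases h : c ≤ ∑ j ∈ s, w j
    · obtain ⟨A, hA, h⟩ := ih (fun j hj => hw j (mem_insert_of_mem hj)) h
      exact ⟨A, hA.trans (subset_insert _ _), h⟩
    · refine ⟨insert k s, subset_rfl, hs, ?_⟩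
      rw [sum_insert hk]
      linarith [hw k (mem_insert_self _ _)]

/-- **Corollary (FKN for partitions).** If a Boolean function `f` on `{−1,1}^m` has its
Fourier weight, up to `ε · Var f`, on coefficients that do not cross a partition
`I₁, …, I_n` of the coordinates, then for some `k` the function `f` is
`61442·ε`-close to `f_k + f̂(∅)`, where `f_k = ∑_{∅ ≠ S ⊆ I_k} f̂(S)·χ_S`. -/
theorem fkn_partition {m n : ℕ} (f : (Fin m → Bool) → ℝ)
    (hfBool : ∀ x, f x = 1 ∨ f x = -1)
    (I : Fin n → Finset (Fin m))
    (hdisj : ∀ j j', j ≠ j' → Disjoint (I j) (I j'))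
    (hcover : Finset.univ.biUnion I = Finset.univ)
    (ε : ℝ) (hε : 0 ≤ ε)
    (hconc :
      ∑ S ∈ Finset.univ.filter (fun S : Finset (Fin m) => ∃ j, S ⊆ I j), coeff f S ^ 2 ≥
        1 - ε * ∑ S ∈ Finset.univ.erase (∅ : Finset (Fin m)), coeff f S ^ 2) :
    ∃ k : Fin n,
      expect (fun x =>
          (f x - (∑ S ∈ ((I k).powerset.erase ∅), coeff f S * chi S x) - coeff f ∅) ^ 2) ≤
        61442 * ε := by
  have hn : 0 < n := by
    rcases Nat.eq_zero_or_pos n with rfl | h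
    · have hm (x : Fin m) : False := by simpa using hcover.ge (mem_univ x)
      have : IsEmpty (Fin m) := ⟨hm⟩
      have hempty : (univ : Finset (Finset (Fin m))).erase ∅ = ∅ := by
        ext S
        simp [Subsingleton.elim S ∅]
      rw [hempty] at hconc
      norm_num at hconc
    · exact h
  set w : Fin n → ℝ := fun j => ∑ S ∈ (I j).powerset.erase ∅, coeff f S ^ 2
  have hpd : (Set.univ : Set (Fin n)).PairwiseDisjoint fun j => (I j).powerset.erase ∅ := by
    intro j _ j' _ hj
    refine Finset.disjoint_left.mpr fun S hS hS' => ?_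
    simp only [mem_erase, mem_powerset] at hS hS'
    exact hS.1 (disjoint_self.mp ((hdisj j j' hj).mono hS.2 hS'.2))
  have hsum (J : Finset (Fin n)) : ∑ j ∈ J, w j
      = ∑ S ∈ J.biUnion fun j => (I j).powerset.erase ∅, coeff f S ^ 2 :=
    (sum_biUnion (hpd.subset (Set.subset_univ _))).symm
  have hV : ∑ S ∈ univ.erase (∅ : Finset (Fin m)), coeff f S ^ 2 = 1 - coeff f ∅ ^ 2 := by
    rw [eq_sub_iff_add_eq, sum_erase_add _ _ (mem_univ _), sum_coeff_sq_eq_one hfBool]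
  have hT : ∑ S ∈ univ.filter (fun S : Finset (Fin m) => ∃ j, S ⊆ I j), coeff f S ^ 2
      = coeff f ∅ ^ 2 + ∑ j, w j := by
    rw [hsum, ← add_sum_erase _ (fun S => coeff f S ^ 2) (a := ∅) (by simp; exact ⟨⟨0, hn⟩⟩)]
    congr 2
    ext S
    simp
  have hdist (k : Fin n) : expect (fun x =>
      (f x - (∑ S ∈ (I k).powerset.erase ∅, coeff f S * chi S x) - coeff f ∅) ^ 2)
      = 1 - coeff f ∅ ^ 2 - w k := by
    have hx (x : Fin m → Bool) :
        f x - (∑ S ∈ (I k).powerset.erase ∅, coeff f S * chi S x) - coeff f ∅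
          = ∑ S, (if S ∈ (I k).powerset then 0 else coeff f S) * chi S x := by
      simp only [ite_mul, zero_mul, sum_ite_mem_zero]
      have h1 := add_sum_erase _ (fun S => coeff f S * chi S x) (empty_mem_powerset (I k))
      have h2 := sum_add_sum_compl (I k).powerset (fun S => coeff f S * chi S x)
      rw [sum_coeff_mul_chi] at h2
      simp only [show chi ∅ x = 1 from prod_empty, mul_one] at h1
      linarith
    simp only [hx, expect_sq_sum_chi, ite_pow, zero_pow two_ne_zero, sum_ite_mem_zero]
    have h1 := add_sum_erase _ (fun S => coeff f S ^ 2) (empty_mem_powerset (I k))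
    have h2 := sum_add_sum_compl (I k).powerset (fun S => coeff f S ^ 2)
    rw [sum_coeff_sq_eq_one hfBool] at h2
    linarith
  have hprod (J : Finset (Fin n)) :
      (∑ j ∈ J, w j) * (∑ j, w j - ∑ j ∈ J, w j) ≤ 8 * (1 - coeff f ∅ ^ 2 - ∑ j, w j) := by
    have hJ : ∑ j ∈ J, w j ≤ ∑ S ∈ (J.biUnion I).powerset.erase ∅, coeff f S ^ 2 := by
      rw [hsum]
      refine sum_le_sum_of_subset_of_nonneg (fun S hS => ?_) fun _ _ _ => sq_nonneg _
      simp only [mem_biUnion, mem_erase, mem_powerset] at hS ⊢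
      obtain ⟨j, hj, hS0, hS⟩ := hS
      exact ⟨hS0, hS.trans (subset_biUnion_of_mem I hj)⟩
    have hJc : ∑ j ∈ Jᶜ, w j ≤ ∑ S ∈ (J.biUnion I)ᶜ.powerset.erase ∅, coeff f S ^ 2 := by
      rw [hsum]
      refine sum_le_sum_of_subset_of_nonneg (fun S hS => ?_) fun _ _ _ => sq_nonneg _
      simp only [mem_biUnion, mem_erase, mem_powerset, mem_compl] at hS ⊢
      obtain ⟨j, hj, hS0, hS⟩ := hS
      refine ⟨hS0, hS.trans (subset_compl_iff_disjoint_right.mpr ?_)⟩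
      exact (disjoint_biUnion_right _ _ _).mpr fun j' hj' =>
        hdisj j j' fun h => hj (h ▸ hj')
    have h := weight_mul_weight_compl_le hfBool (J.biUnion I)
    have hadd := sum_add_sum_compl J w
    have hJ0 : 0 ≤ ∑ j ∈ J, w j := sum_nonneg fun _ _ => sum_nonneg fun _ _ => sq_nonneg _
    have hJc0 : 0 ≤ ∑ j ∈ Jᶜ, w j := sum_nonneg fun _ _ => sum_nonneg fun _ _ => sq_nonneg _
    have hmul := mul_le_mul hJ hJc hJc0 (hJ0.trans hJ)
    rw [← hadd, add_sub_cancel_left]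
    linarith
  rw [hT, hV] at hconc
  simp only [hdist]
  have hw0 (j : Fin n) : 0 ≤ w j := sum_nonneg fun _ _ => sq_nonneg _
  have hV0 : 0 ≤ 1 - coeff f ∅ ^ 2 := hV ▸ sum_nonneg fun _ _ => sq_nonneg _
  have hV1 : 1 - coeff f ∅ ^ 2 ≤ 1 := sub_le_self _ (sq_nonneg _)
  have hδ : 1 - coeff f ∅ ^ 2 - ∑ j, w j ≤ ε * (1 - coeff f ∅ ^ 2) := by linarith
  generalize 1 - coeff f ∅ ^ 2 = V at *
  have hT0 : 0 ≤ ∑ j, w j := sum_nonneg fun j _ => hw0 j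
  generalize hTsum : ∑ j, w j = T at *
  rcases hV0.eq_or_lt with rfl | hVpos
  · exact ⟨⟨0, hn⟩, by linarith [hw0 ⟨0, hn⟩]⟩
  rcases le_or_gt (1 / 2) ε with hε2 | hε2
  · exact ⟨⟨0, hn⟩, by linarith [hw0 ⟨0, hn⟩]⟩
  have hVT : V ≤ 2 * T := by nlinarith
  by_cases hbig : ∃ k, T / 3 ≤ w k
  · obtain ⟨k, hk⟩ := hbig
    refine ⟨k, ?_⟩
    have h := hprod {k}
    rw [sum_singleton] at h
    suffices T - w k ≤ 48 * ε by nlinarith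
    by_contra! hlt
    have h1 : V * (48 * ε) < V * (T - w k) := mul_lt_mul_of_pos_left hlt hVpos
    have h2 : V / 6 * (T - w k) ≤ w k * (T - w k) :=
      mul_le_mul_of_nonneg_right (by linarith) (by linarith)
    nlinarith
  · push Not at hbig
    obtain ⟨A, -, hA1, hA2⟩ := exists_subset_sum_mem_Icc w univ (fun j _ => (hbig j).le)
      (hTsum ▸ by linarith) (by linarith : 0 ≤ T / 3)
    refine ⟨⟨0, hn⟩, ?_⟩
    have h := hprod A
    have h1 : 2 / 9 * T ^ 2 ≤ 8 * (ε * V) := by nlinarith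
    have h2 : T ≤ 72 * ε := by
      by_contra! hlt
      nlinarith [mul_lt_mul_of_pos_left hlt hVpos]
    nlinarith [hw0 ⟨0, hn⟩]
end

section
/- There exists a universal constant K > 0 such that the following holds (the FKN Theorem). For every n, every ε ≥ 0, and every Boolean function f : {−1,1}^n → {−1,1} whose Fourier transform is concentrated on the first two levels, i.e., ∑_{S : |S| ≤ 1} f̂(S)² ≥ 1 − ε, either there exists σ ∈ {−1,1} with ‖f − σ‖₂² ≤ K·ε (f is close to a constant function), or there exist k ∈ {1,…,n} and σ ∈ {−1,1} with ‖f − σ·x_k‖₂² ≤ K·ε (f is close to a dictatorship). -/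
open Finset

/-- The affine form `b + ∑ i, a i * x i` on the Boolean cube. -/
def affineForm {n : ℕ} (b : ℝ) (a : Fin n → ℝ) (x : Fin n → Bool) : ℝ :=
  b + ∑ i, a i * toSign (x i)

section Expectation

variable {n : ℕ} (g h : (Fin n → Bool) → ℝ)

lemma expect_add : expect (fun x => g x + h x) = expect g + expect h := by
  simp [_root_.expect, Finset.sum_add_distrib, add_div]

lemma expect_sub : expect (fun x => g x - h x) = expect g - expect h := by
  simp [_root_.expect, Finset.sum_sub_distrib, sub_div]

lemma expect_const_mul (c : ℝ) : expect (fun x => c * g x) = c * expect g := by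
  simp [_root_.expect, ← Finset.mul_sum, mul_div_assoc]

lemma expect_const (c : ℝ) : expect (fun _ : Fin n → Bool => c) = c := by
  simp [_root_.expect]

lemma expect_sum {ι : Type*} (s : Finset ι) (G : ι → (Fin n → Bool) → ℝ) :
    expect (fun x => ∑ i ∈ s, G i x) = ∑ i ∈ s, expect (G i) := by
  simp only [_root_.expect]
  rw [Finset.sum_comm, Finset.sum_div]

variable {g h} in
lemma expect_mono (hgh : ∀ x, g x ≤ h x) : expect g ≤ expect h := by
  unfold _root_.expect
  gcongr with x
  exact hgh x

variable {g} in
lemma expect_nonneg (hg : ∀ x, 0 ≤ g x) : 0 ≤ expect g := by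
  simpa [expect_const] using expect_mono hg

/-- The Cauchy–Schwarz inequality for expectations over the cube. -/
lemma expect_mul_sq_le :
    expect (fun x => g x * h x) ^ 2 ≤ expect (fun x => g x ^ 2) * expect (fun x => h x ^ 2) := by
  simp only [_root_.expect]
  rw [div_pow, div_mul_div_comm, ← sq]
  gcongr
  exact Finset.sum_mul_sq_le_sq_mul_sq _ _ _

lemma expect_zero_dim (g : (Fin 0 → Bool) → ℝ) : expect g = g default := by
  rw [_root_.expect, Fintype.sum_unique, pow_zero, div_one]
  exact congrArg g (Subsingleton.elim _ _)

/-- Averaging over the first coordinate. -/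
lemma expect_succ (g : (Fin (n + 1) → Bool) → ℝ) :
    expect g =
      expect (fun x => (g (Fin.cons true x) + g (Fin.cons false x)) / 2) := by
  unfold _root_.expect
  rw [← (Fin.consEquiv fun _ : Fin (n + 1) => Bool).sum_comp, Fintype.sum_prod_type]
  simp only [Fintype.sum_bool, ← Finset.sum_add_distrib, ← Finset.sum_div]
  rw [pow_succ, div_div, mul_comm]
  rfl

end Expectation

lemma affineForm_cons {n : ℕ} (b : ℝ) (a : Fin (n + 1) → ℝ) (t : Bool) (x : Fin n → Bool) :
    affineForm b a (Fin.cons t x) = affineForm b (Fin.tail a) x + a 0 * toSign t := by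
  simp only [affineForm, Fin.sum_univ_succ, Fin.cons_zero, Fin.cons_succ, Fin.tail]
  ring

lemma expect_affineForm_sq {n : ℕ} (b : ℝ) (a : Fin n → ℝ) :
    expect (fun x => affineForm b a x ^ 2) = b ^ 2 + ∑ i, a i ^ 2 := by
  induction n with
  | zero => simp [expect_zero_dim, affineForm]
  | succ n ih =>
    have hx : ∀ x : Fin n → Bool,
        (affineForm b a (Fin.cons true x) ^ 2 + affineForm b a (Fin.cons false x) ^ 2) / 2 =
          affineForm b (Fin.tail a) x ^ 2 + a 0 ^ 2 := by
      intro x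
      simp only [affineForm_cons, toSign]
      norm_num
      ring
    rw [expect_succ]
    simp only [hx, expect_add, expect_const, ih, Fin.sum_univ_succ, Fin.tail]
    ring

lemma expect_affineForm_pow_four {n : ℕ} (b : ℝ) (a : Fin n → ℝ) :
    expect (fun x => affineForm b a x ^ 4) =
      3 * (b ^ 2 + ∑ i, a i ^ 2) ^ 2 - 2 * (b ^ 4 + ∑ i, a i ^ 4) := by
  induction n with
  | zero =>
    simp only [expect_zero_dim, affineForm, Finset.univ_eq_empty, Finset.sum_empty]
    ring
  | succ n ih =>
    have hx : ∀ x : Fin n → Bool,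
        (affineForm b a (Fin.cons true x) ^ 4 + affineForm b a (Fin.cons false x) ^ 4) / 2 =
          affineForm b (Fin.tail a) x ^ 4 + 6 * a 0 ^ 2 * affineForm b (Fin.tail a) x ^ 2
            + a 0 ^ 4 := by
      intro x
      simp only [affineForm_cons, toSign]
      norm_num
      ring
    rw [expect_succ]
    simp only [hx, expect_add, expect_const, expect_const_mul, ih, expect_affineForm_sq,
      Fin.sum_univ_succ, Fin.tail]
    ring

lemma expect_affineForm_pow_four_le {n : ℕ} (b : ℝ) (a : Fin n → ℝ) :
    expect (fun x => affineForm b a x ^ 4) ≤ 3 * expect (fun x => affineForm b a x ^ 2) ^ 2 := by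
  rw [expect_affineForm_pow_four, expect_affineForm_sq]
  have : 0 ≤ b ^ 4 + ∑ i, a i ^ 4 := by positivity
  linarith

/-- Bonami's lemma for the quadratic polynomials which are a constant plus the square of an
affine form. -/
lemma expect_affineForm_sq_add_pow_four_le {n : ℕ} (b c : ℝ) (a : Fin n → ℝ) :
    expect (fun x => (affineForm b a x ^ 2 + c) ^ 4) ≤
      81 * expect (fun x => (affineForm b a x ^ 2 + c) ^ 2) ^ 2 := by
  induction n generalizing c with
  | zero =>
    simp only [expect_zero_dim]
    nlinarith [sq_nonneg ((affineForm b a default ^ 2 + c) ^ 2)]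
  | succ n ih =>
    set l := affineForm b (Fin.tail a) with hl
    set u : (Fin n → Bool) → ℝ := fun x => l x ^ 2 + (a 0 ^ 2 + c) with hu
    set v : (Fin n → Bool) → ℝ := fun x => 2 * a 0 * l x with hv
    have hU : expect (fun x => u x ^ 4) ≤ 81 * expect (fun x => u x ^ 2) ^ 2 :=
      ih (a 0 ^ 2 + c) (Fin.tail a)
    have hV : expect (fun x => v x ^ 4) ≤ 3 * expect (fun x => v x ^ 2) ^ 2 := by
      simp only [hv, mul_pow _ (l _), expect_const_mul]
      have := mul_le_mul_of_nonneg_left (expect_affineForm_pow_four_le b (Fin.tail a))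
        (by positivity : 0 ≤ (2 * a 0) ^ 4)
      rw [← hl] at this
      linarith
    have hU0 : 0 ≤ expect (fun x => u x ^ 2) := expect_nonneg fun x => by positivity
    have hV0 : 0 ≤ expect (fun x => v x ^ 2) := expect_nonneg fun x => by positivity
    have hUV : expect (fun x => u x ^ 2 * v x ^ 2) ≤
        27 * expect (fun x => u x ^ 2) * expect (fun x => v x ^ 2) := by
      have hcs := expect_mul_sq_le (fun x => u x ^ 2) (fun x => v x ^ 2)
      simp only [← pow_mul] at hcs
      have hmul := mul_le_mul hU hV (expect_nonneg fun x => by positivity) (by positivity)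
      refine abs_le_of_sq_le_sq' ?_ (by positivity) |>.2
      norm_num at hcs hmul
      nlinarith [sq_nonneg (expect (fun x => u x ^ 2) * expect (fun x => v x ^ 2))]
    have hx4 : ∀ x : Fin n → Bool,
        ((affineForm b a (Fin.cons true x) ^ 2 + c) ^ 4 +
          (affineForm b a (Fin.cons false x) ^ 2 + c) ^ 4) / 2 =
          u x ^ 4 + 6 * (u x ^ 2 * v x ^ 2) + v x ^ 4 := by
      intro x
      simp only [affineForm_cons, toSign, hu, hv, ← hl]
      norm_num
      ring
    have hx2 : ∀ x : Fin n → Bool,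
        ((affineForm b a (Fin.cons true x) ^ 2 + c) ^ 2 +
          (affineForm b a (Fin.cons false x) ^ 2 + c) ^ 2) / 2 = u x ^ 2 + v x ^ 2 := by
      intro x
      simp only [affineForm_cons, toSign, hu, hv, ← hl]
      norm_num
      ring
    rw [expect_succ, expect_succ (fun x => (affineForm b a x ^ 2 + c) ^ 2)]
    simp only [hx4, hx2, expect_add, expect_const_mul]
    nlinarith [sq_nonneg (expect (fun x => v x ^ 2))]

lemma chi_empty {n : ℕ} (x : Fin n → Bool) : chi ∅ x = 1 := by simp [chi]

lemma chi_singleton {n : ℕ} (i : Fin n) (x : Fin n → Bool) : chi {i} x = toSign (x i) := by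
  simp [chi]

lemma sum_card_le_one {n : ℕ} (F : Finset (Fin n) → ℝ) :
    ∑ S ∈ Finset.univ.filter (fun S : Finset (Fin n) => S.card ≤ 1), F S =
      F ∅ + ∑ i, F {i} := by
  have hset : Finset.univ.filter (fun S : Finset (Fin n) => S.card ≤ 1) =
      insert ∅ (Finset.univ.map ⟨fun i : Fin n => ({i} : Finset (Fin n)),
        Finset.singleton_injective⟩) := by
    ext S
    simp [Nat.le_one_iff_eq_zero_or_eq_one, Finset.card_eq_one, eq_comm]
  rw [hset, Finset.sum_insert (by simp), Finset.sum_map]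
  rfl

/-- The projection of `f` to the first two Fourier levels is at squared distance
`E[f²] - ∑_{|S| ≤ 1} f̂(S)²` from `f`. -/
lemma expect_sub_affineForm_sq {n : ℕ} (f : (Fin n → Bool) → ℝ) :
    expect (fun x => (f x - affineForm (coeff f ∅) (fun i => coeff f {i}) x) ^ 2) =
      expect (fun x => f x ^ 2) - (coeff f ∅ ^ 2 + ∑ i, coeff f {i} ^ 2) := by
  have hinner : expect (fun x => f x * affineForm (coeff f ∅) (fun i => coeff f {i}) x) =
      coeff f ∅ ^ 2 + ∑ i, coeff f {i} ^ 2 := by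
    have hx : ∀ x, f x * affineForm (coeff f ∅) (fun i => coeff f {i}) x =
        coeff f ∅ * (f x * chi ∅ x) + ∑ i, coeff f {i} * (f x * chi {i} x) := by
      intro x
      simp only [affineForm, chi_empty, chi_singleton, mul_add, Finset.mul_sum]
      congr 1
      · ring
      · exact Finset.sum_congr rfl fun i _ => by ring
    simp only [hx, expect_add, expect_sum, expect_const_mul]
    simp only [← coeff.eq_def, sq]
  have hx : ∀ x, (f x - affineForm (coeff f ∅) (fun i => coeff f {i}) x) ^ 2 =
      f x ^ 2 - 2 * (f x * affineForm (coeff f ∅) (fun i => coeff f {i}) x) +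
        affineForm (coeff f ∅) (fun i => coeff f {i}) x ^ 2 := fun x => by ring
  simp only [hx, expect_add, expect_sub, expect_const_mul, hinner, expect_affineForm_sq]
  ring

/-- Bessel's inequality on the first two Fourier levels. -/
lemma level_le_one_weight_le {n : ℕ} (f : (Fin n → Bool) → ℝ) :
    coeff f ∅ ^ 2 + ∑ i, coeff f {i} ^ 2 ≤ expect (fun x => f x ^ 2) := by
  rw [← sub_nonneg, ← expect_sub_affineForm_sq]
  exact expect_nonneg fun x => sq_nonneg _

lemma chi_sq {n : ℕ} (S : Finset (Fin n)) (x : Fin n → Bool) : chi S x ^ 2 = 1 := by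
  rw [chi, ← Finset.prod_pow]
  exact Finset.prod_eq_one fun i _ => by cases x i <;> simp [toSign]

/-- A Boolean function with a Fourier coefficient of square at least `1 - δ` is `2δ`-close to the
corresponding signed character. -/
lemma exists_sign_expect_sub_chi_sq_le {n : ℕ} {f : (Fin n → Bool) → ℝ}
    (hf : ∀ x, f x ^ 2 = 1) {S : Finset (Fin n)} {δ : ℝ} (h1 : coeff f S ^ 2 ≤ 1)
    (hδ : 1 - δ ≤ coeff f S ^ 2) :
    ∃ σ : ℝ, (σ = 1 ∨ σ = -1) ∧ expect (fun x => (f x - σ * chi S x) ^ 2) ≤ 2 * δ := by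
  have key : ∀ σ : ℝ, σ ^ 2 = 1 →
      expect (fun x => (f x - σ * chi S x) ^ 2) = 2 - 2 * σ * coeff f S := by
    intro σ hσ
    have hx : ∀ x, (f x - σ * chi S x) ^ 2 = 2 - 2 * σ * (f x * chi S x) := by
      intro x
      linear_combination hf x + chi S x ^ 2 * hσ + chi_sq S x
    simp only [hx, expect_sub, expect_const, expect_const_mul]
    rfl
  rcases le_total 0 (coeff f S) with h0 | h0
  · refine ⟨1, Or.inl rfl, ?_⟩
    rw [key 1 (by norm_num)]
    nlinarith
  · refine ⟨-1, Or.inr rfl, ?_⟩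
    rw [key (-1) (by norm_num)]
    nlinarith

/-- If the Fourier weight of a Boolean function on the first two levels is close to `1`, so is the
sum of the fourth powers of its coefficients there. -/
lemma sum_coeff_pow_four_ge {n : ℕ} {f : (Fin n → Bool) → ℝ} (hf : ∀ x, f x ^ 2 = 1)
    {ε : ℝ} (hε : 1 - ε ≤ coeff f ∅ ^ 2 + ∑ i, coeff f {i} ^ 2) (hε1 : ε ≤ 1) :
    1 - 46 * ε ≤ coeff f ∅ ^ 4 + ∑ i, coeff f {i} ^ 4 := by
  have hdist := expect_sub_affineForm_sq f
  simp only [hf, expect_const] at hdist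
  have h2 := expect_affineForm_sq (coeff f ∅) (fun i => coeff f {i})
  have h4 := expect_affineForm_pow_four (coeff f ∅) (fun i => coeff f {i})
  have hB := expect_affineForm_sq_add_pow_four_le (coeff f ∅) (-1) (fun i => coeff f {i})
  set l := affineForm (coeff f ∅) (fun i => coeff f {i})
  set s := coeff f ∅ ^ 2 + ∑ i, coeff f {i} ^ 2
  have hQ0 : 0 ≤ coeff f ∅ ^ 4 + ∑ i, coeff f {i} ^ 4 := by positivity
  set Q := coeff f ∅ ^ 4 + ∑ i, coeff f {i} ^ 4
  have hs1 : s ≤ 1 := by simpa [hf, expect_const] using level_le_one_weight_le f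
  have hP : expect (fun x => (l x ^ 2 + -1) ^ 2) = 2 * (s ^ 2 - Q) + (1 - s) ^ 2 := by
    have hx : ∀ x, (l x ^ 2 + -1) ^ 2 = l x ^ 4 - 2 * l x ^ 2 + 1 := fun x => by ring
    simp only [hx, expect_add, expect_sub, expect_const, expect_const_mul, h2, h4]
    ring
  -- truncation at `l² - 1 = 27`
  have hpt : ∀ x, (l x ^ 2 + -1) ^ 2 ≤
      58 * (f x - l x) ^ 2 + 1 / 729 * (l x ^ 2 + -1) ^ 4 := by
    intro x
    have hfac : (l x ^ 2 + -1) ^ 2 = (f x - l x) ^ 2 * (f x + l x) ^ 2 := by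
      rw [← hf x]
      ring
    have hsum : (f x + l x) ^ 2 ≤ 2 * (l x ^ 2 + -1) + 4 := by
      nlinarith [sq_nonneg (f x - l x), hf x]
    rcases le_total (l x ^ 2 + -1) 27 with hle | hge
    · have hmul := mul_le_mul_of_nonneg_left (by linarith : (f x + l x) ^ 2 ≤ 58)
        (sq_nonneg (f x - l x))
      have : 0 ≤ (l x ^ 2 + -1) ^ 4 := by positivity
      linarith
    · have hsq : 729 ≤ (l x ^ 2 + -1) ^ 2 := by nlinarith
      nlinarith [sq_nonneg (f x - l x), sq_nonneg (l x ^ 2 + -1)]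
  have hE := expect_mono hpt
  simp only [expect_add, expect_const_mul] at hE
  have hs0 : 0 ≤ s := by linarith
  have hP0 : 0 ≤ expect (fun x => (l x ^ 2 + -1) ^ 2) := expect_nonneg fun x => by positivity
  have hP3 : expect (fun x => (l x ^ 2 + -1) ^ 2) ≤ 3 := by
    rw [hP]
    nlinarith
  nlinarith

/-- **FKN Theorem.** There is a universal constant `K > 0` such that every Boolean function
whose Fourier transform has weight at least `1 − ε` on the levels `0` and `1` is
`K·ε`-close to a constant function `σ ∈ {±1}` or to a dictatorship `σ·x_k`. -/
theorem fkn_theorem :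
    ∃ K : ℝ, 0 < K ∧
      ∀ (n : ℕ) (ε : ℝ), 0 ≤ ε →
        ∀ f : (Fin n → Bool) → ℝ, (∀ x, f x = 1 ∨ f x = -1) →
          (∑ S ∈ Finset.univ.filter (fun S : Finset (Fin n) => S.card ≤ 1), coeff f S ^ 2 ≥
            1 - ε) →
          (∃ σ : ℝ, (σ = 1 ∨ σ = -1) ∧ expect (fun x => (f x - σ) ^ 2) ≤ K * ε) ∨
          (∃ (k : Fin n) (σ : ℝ), (σ = 1 ∨ σ = -1) ∧
            expect (fun x => (f x - σ * toSign (x k)) ^ 2) ≤ K * ε) := by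
  refine ⟨100, by norm_num, fun n ε hε0 f hf hε => ?_⟩
  have hf2 : ∀ x, f x ^ 2 = 1 := fun x => by rcases hf x with h | h <;> simp [h]
  rw [sum_card_le_one (fun S => coeff f S ^ 2), ge_iff_le] at hε
  rcases lt_or_ge 1 ε with hε1 | hε1
  · refine Or.inl ⟨1, Or.inl rfl, ?_⟩
    have hle : ∀ x, (f x - 1) ^ 2 ≤ 4 := fun x => by rcases hf x with h | h <;> norm_num [h]
    have := expect_mono hle
    rw [expect_const] at this
    linarith
  have hQ := sum_coeff_pow_four_ge hf2 hε hε1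
  have hs1 : coeff f ∅ ^ 2 + ∑ i, coeff f {i} ^ 2 ≤ 1 := by
    simpa [hf2, expect_const] using level_le_one_weight_le f
  have hsum0 : 0 ≤ ∑ i, coeff f {i} ^ 2 := by positivity
  by_cases h0 : 1 - 46 * ε ≤ coeff f ∅ ^ 2
  · left
    obtain ⟨σ, hσ, h⟩ := exists_sign_expect_sub_chi_sq_le hf2 (by linarith) h0
    simp only [chi_empty, mul_one] at h
    exact ⟨σ, hσ, by linarith⟩
  by_cases h1 : ∃ k, 1 - 46 * ε ≤ coeff f {k} ^ 2
  · right
    obtain ⟨k, hk⟩ := h1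
    have hk1 : coeff f {k} ^ 2 ≤ ∑ i, coeff f {i} ^ 2 :=
      Finset.single_le_sum (f := fun i => coeff f {i} ^ 2) (fun i _ => sq_nonneg _)
        (Finset.mem_univ k)
    obtain ⟨σ, hσ, h⟩ :=
      exists_sign_expect_sub_chi_sq_le hf2 (by linarith [sq_nonneg (coeff f ∅)]) hk
    simp only [chi_singleton] at h
    exact ⟨k, σ, hσ, by linarith⟩
  exfalso
  push Not at h0 h1
  have hm : 0 < 1 - 46 * ε := (sq_nonneg _).trans_lt h0
  have hb0 : 0 ≤ coeff f ∅ ^ 2 * (1 - 46 * ε - coeff f ∅ ^ 2) :=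
    mul_nonneg (sq_nonneg _) (by linarith)
  have ha0 : ∀ i ∈ Finset.univ, 0 ≤ coeff f {i} ^ 2 * (1 - 46 * ε - coeff f {i} ^ 2) :=
    fun i _ => mul_nonneg (sq_nonneg _) (by linarith [h1 i])
  have hsplit : ∑ i, coeff f {i} ^ 2 * (1 - 46 * ε - coeff f {i} ^ 2) =
      (∑ i, coeff f {i} ^ 2) * (1 - 46 * ε) - ∑ i, coeff f {i} ^ 4 := by
    rw [Finset.sum_mul, ← Finset.sum_sub_distrib]
    exact Finset.sum_congr rfl fun i _ => by ring
  have hA0 := Finset.sum_nonneg ha0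
  have htot : coeff f ∅ ^ 2 * (1 - 46 * ε - coeff f ∅ ^ 2) +
      ∑ i, coeff f {i} ^ 2 * (1 - 46 * ε - coeff f {i} ^ 2) ≤ 0 := by
    rw [hsplit]
    nlinarith
  have hb : coeff f ∅ = 0 := by
    have hmul : coeff f ∅ ^ 2 * (1 - 46 * ε - coeff f ∅ ^ 2) = 0 := by linarith
    rcases mul_eq_zero.mp hmul with h | h
    · exact pow_eq_zero_iff two_ne_zero |>.mp h
    · linarith
  have ha : ∀ i, coeff f {i} = 0 := by
    intro i
    have hmul := (Finset.sum_eq_zero_iff_of_nonneg ha0).mp (by linarith) i (Finset.mem_univ i)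
    rcases mul_eq_zero.mp hmul with h | h
    · exact pow_eq_zero_iff two_ne_zero |>.mp h
    · linarith [h1 i]
  simp only [hb, ha] at hQ
  norm_num at hQ
  linarith
end

section
/- Let v₁, …, v_n be nonnegative real numbers, let V = ∑_{i=1}^n v_i, and suppose that v_i ≤ 2V/3 for every i. Then there exists a subset A ⊆ {1,…,n} such that V/3 ≤ ∑_{i∈A} v_i ≤ 2V/3 (and hence also V/3 ≤ ∑_{i∉A} v_i ≤ 2V/3). -/
open Finset

/-- **Partition of weights.** If `v₁, …, v_n ≥ 0` sum to `V` and each `v_i ≤ 2V/3`,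
then there is a subset `A` with `V/3 ≤ ∑_{i∈A} v_i ≤ 2V/3` (and hence the same bounds
hold for the complementary sum). -/
theorem exists_balanced_subset {n : ℕ} (v : Fin n → ℝ) (hv : ∀ i, 0 ≤ v i)
    (V : ℝ) (hV : V = ∑ i, v i) (hle : ∀ i, v i ≤ 2 * V / 3) :
    ∃ A : Finset (Fin n),
      (V / 3 ≤ ∑ i ∈ A, v i ∧ ∑ i ∈ A, v i ≤ 2 * V / 3) ∧
      (V / 3 ≤ ∑ i ∈ Aᶜ, v i ∧ ∑ i ∈ Aᶜ, v i ≤ 2 * V / 3) := by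
  have hV0 : 0 ≤ V := hV ▸ Finset.sum_nonneg fun i _ => hv i
  suffices h : ∃ A : Finset (Fin n), V / 3 ≤ ∑ i ∈ A, v i ∧ ∑ i ∈ A, v i ≤ 2 * V / 3 by
    obtain ⟨A, h₁, h₂⟩ := h
    have hA := Finset.sum_add_sum_compl A v
    exact ⟨A, ⟨h₁, h₂⟩, by linarith, by linarith⟩
  by_contra! h
  have hsmall (i : Fin n) : v i < V / 3 := by
    by_contra! hi
    have hlt := h {i} (by simpa using hi)
    rw [Finset.sum_singleton] at hlt
    exact (hle i).not_gt hlt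
  have hsum (S : Finset (Fin n)) : ∑ i ∈ S, v i < V / 3 := by
    induction S using Finset.induction_on with
    | empty =>
      by_contra! hS
      have hlt := h ∅ hS
      rw [Finset.sum_empty] at hlt
      linarith
    | insert i S hi ih =>
      by_contra! hS
      have hlt := h _ hS
      rw [Finset.sum_insert hi] at hlt
      linarith [hsmall i]
  linarith [hsum Finset.univ]
end

section
/- Let μ be a Borel probability measure on ℝ with finite first moment and mean zero (∫ x dμ(x) = 0). For each pair (a, b) with a ≤ 0 ≤ b, let ν_{a,b} be the unique mean-zero probability measure supported on {a, b}: ν_{a,b} = (b/(b−a))·δ_a + ((−a)/(b−a))·δ_b when (a,b) ≠ (0,0), and ν_{0,0} = δ_0. Then μ is a mixture of such two-point mean-zero measures: there exists a Borel probability measure π on {(a, b) ∈ ℝ² : a ≤ 0 ≤ b} such that μ(A) = ∫ ν_{a,b}(A) dπ(a, b) for every Borel set A ⊆ ℝ. -/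
open MeasureTheory

/-- The unique mean-zero probability measure on `ℝ` supported on `{a, b}` (for
`a ≤ 0 ≤ b`): `ν_{a,b} = (b/(b−a))·δ_a + ((−a)/(b−a))·δ_b` when `(a,b) ≠ (0,0)`,
and `ν_{0,0} = δ_0`. -/
noncomputable def twoPointMeasure (a b : ℝ) : Measure ℝ :=
  open Classical in
  if a = 0 ∧ b = 0 then Measure.dirac 0
  else ENNReal.ofReal (b / (b - a)) • Measure.dirac a +
       ENNReal.ofReal (-a / (b - a)) • Measure.dirac b

/-- `ν_{a,b}` weighted by `b - a` for `a < 0 < b`. -/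
lemma ofReal_sub_mul_twoPointMeasure {a b : ℝ} (ha : a < 0) (hb : 0 < b) {A : Set ℝ}
    (hA : MeasurableSet A) :
    ENNReal.ofReal (b - a) * twoPointMeasure a b A =
      A.indicator 1 a * ENNReal.ofReal b + ENNReal.ofReal (-a) * A.indicator 1 b := by
  have hba : 0 < b - a := by linarith
  have hweight (c : ℝ) : ENNReal.ofReal (b - a) * ENNReal.ofReal (c / (b - a)) =
      ENNReal.ofReal c := by
    rw [← ENNReal.ofReal_mul hba.le, mul_div_cancel₀ _ hba.ne']
  rw [twoPointMeasure, if_neg (fun h => ha.ne h.1)]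
  simp only [Measure.coe_add, Measure.coe_smul, Pi.add_apply, Pi.smul_apply, smul_eq_mul,
    Measure.dirac_apply' _ hA]
  rw [mul_add, ← mul_assoc, ← mul_assoc, hweight, hweight, mul_comm (ENNReal.ofReal b)]

/-- For `a ≤ 0 ≤ b` the measure `ν_{a,b}` has total mass one. -/
lemma twoPointMeasure_univ {a b : ℝ} (ha : a ≤ 0) (hb : 0 ≤ b) :
    twoPointMeasure a b Set.univ = 1 := by
  rw [twoPointMeasure]
  split_ifs with h
  · simp
  · have hba : 0 < b - a := by
      rcases ha.lt_or_eq with ha' | rfl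
      · linarith
      · have : b ≠ 0 := fun hb' => h ⟨rfl, hb'⟩
        simpa using lt_of_le_of_ne hb this.symm
    simp only [Measure.coe_add, Measure.coe_smul, Pi.add_apply, Pi.smul_apply, smul_eq_mul,
      measure_univ, mul_one]
    rw [← ENNReal.ofReal_add (by positivity) (div_nonneg (by linarith) hba.le), ← add_div,
      ← sub_eq_add_neg, div_self hba.ne', ENNReal.ofReal_one]

/-- A mean-zero measure has equal first moments on both sides of the origin. -/
lemma setLIntegral_Iio_ofReal_neg_eq_setLIntegral_Ioi_ofReal {μ : Measure ℝ}
    (hint : Integrable (fun x : ℝ => x) μ) (hmean : ∫ x, x ∂μ = 0) :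
    ∫⁻ x in Set.Iio 0, ENNReal.ofReal (-x) ∂μ = ∫⁻ x in Set.Ioi 0, ENNReal.ofReal x ∂μ := by
  have hneg : ∫⁻ x in Set.Iio 0, ENNReal.ofReal (-x) ∂μ = ∫⁻ x, ENNReal.ofReal (-x) ∂μ :=
    setLIntegral_eq_of_support_subset fun x hx => by simpa using hx
  have hpos : ∫⁻ x in Set.Ioi 0, ENNReal.ofReal x ∂μ = ∫⁻ x, ENNReal.ofReal x ∂μ :=
    setLIntegral_eq_of_support_subset fun x hx => by simpa using hx
  rw [hneg, hpos]
  rw [integral_eq_lintegral_pos_part_sub_lintegral_neg_part hint, sub_eq_zero] at hmean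
  exact ((ENNReal.toReal_eq_toReal_iff' hint.lintegral_lt_top.ne
    hint.neg.lintegral_lt_top.ne).1 hmean).symm

/-- Mixing `ν_{a,b}` with weight `b - a` against a product of measures on the two half-lines. -/
lemma lintegral_twoPointMeasure_withDensity_prod {N P : Measure ℝ} [SFinite N] [SFinite P]
    (hN : ∀ᵐ x ∂N, x < 0) (hP : ∀ᵐ x ∂P, 0 < x) {A : Set ℝ} (hA : MeasurableSet A) :
    ∫⁻ p, twoPointMeasure p.1 p.2 A
        ∂(N.prod P).withDensity (fun p => ENNReal.ofReal (p.2 - p.1)) =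
      N A * ∫⁻ x, ENNReal.ofReal x ∂P + (∫⁻ x, ENNReal.ofReal (-x) ∂N) * P A := by
  have hind : Measurable (A.indicator (1 : ℝ → ENNReal)) := measurable_one.indicator hA
  rw [lintegral_withDensity_eq_lintegral_mul_non_measurable _ (by fun_prop)
    (Filter.Eventually.of_forall fun _ => ENNReal.ofReal_lt_top)]
  have hae : ∀ᵐ p ∂N.prod P, p.1 < 0 ∧ 0 < p.2 :=
    (Measure.quasiMeasurePreserving_fst.ae hN).and (Measure.quasiMeasurePreserving_snd.ae hP)
  simp only [Pi.mul_apply]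
  rw [lintegral_congr_ae (hae.mono fun p hp => ofReal_sub_mul_twoPointMeasure hp.1 hp.2 hA),
    lintegral_add_left (by fun_prop),
    lintegral_prod_mul hind.aemeasurable (by fun_prop),
    lintegral_prod_mul (f := fun x => ENNReal.ofReal (-x)) (by fun_prop) hind.aemeasurable,
    lintegral_indicator_one hA, lintegral_indicator_one hA]

/-- **Mixture of two-point mean-zero measures.** Every Borel probability measure on `ℝ`
with finite first moment and mean zero is a mixture of mean-zero measures supported on at
most two points: there is a Borel probability measure `π`, concentrated on
`{(a, b) : a ≤ 0 ≤ b}`, with `μ(A) = ∫ ν_{a,b}(A) dπ(a,b)` for every Borel set `A`. -/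
theorem eq_mixture_of_twoPoint (μ : Measure ℝ) [IsProbabilityMeasure μ]
    (hint : Integrable (fun x : ℝ => x) μ)
    (hmean : ∫ x, x ∂μ = 0) :
    ∃ π : Measure (ℝ × ℝ), IsProbabilityMeasure π ∧
      π {p : ℝ × ℝ | ¬(p.1 ≤ 0 ∧ 0 ≤ p.2)} = 0 ∧
      ∀ A : Set ℝ, MeasurableSet A →
        μ A = ∫⁻ p : ℝ × ℝ, twoPointMeasure p.1 p.2 A ∂π := by
  set N := μ.restrict (Set.Iio 0) with hN_def
  set P := μ.restrict (Set.Ioi 0) with hP_def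
  set m := ∫⁻ x, ENNReal.ofReal x ∂P with hm_def
  have hNm : ∫⁻ x, ENNReal.ofReal (-x) ∂N = m :=
    setLIntegral_Iio_ofReal_neg_eq_setLIntegral_Ioi_ofReal hint hmean
  have hN : ∀ᵐ x ∂N, x < 0 := ae_restrict_mem measurableSet_Iio
  have hP : ∀ᵐ x ∂P, 0 < x := ae_restrict_mem measurableSet_Ioi
  have hm_top : m ≠ ⊤ := ((setLIntegral_le_lintegral _ _).trans_lt hint.lintegral_lt_top).ne
  have hN0 (h : m = 0) : N = 0 := by
    rw [h, lintegral_eq_zero_iff (by fun_prop)] at hNm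
    refine ae_eq_bot.1 (Filter.eventually_false_iff_eq_bot.1 ?_)
    filter_upwards [hNm, hN] with x hx hx'
    simp only [Pi.zero_apply, ENNReal.ofReal_eq_zero] at hx
    linarith
  have hP0 (h : m = 0) : P = 0 := by
    rw [hm_def, lintegral_eq_zero_iff (by fun_prop)] at h
    refine ae_eq_bot.1 (Filter.eventually_false_iff_eq_bot.1 ?_)
    filter_upwards [h, hP] with x hx hx'
    simp only [Pi.zero_apply, ENNReal.ofReal_eq_zero] at hx
    linarith
  set π : Measure (ℝ × ℝ) := μ {0} • Measure.dirac (0, 0) +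
    m⁻¹ • (N.prod P).withDensity (fun p => ENNReal.ofReal (p.2 - p.1)) with hπ_def
  have hsupp : ∀ᵐ p ∂π, p.1 ≤ 0 ∧ 0 ≤ p.2 := by
    rw [hπ_def, ae_add_measure_iff]
    constructor
    · exact Measure.ae_smul_measure (by simp [ae_dirac_eq]) _
    · refine Measure.ae_smul_measure ((withDensity_absolutelyContinuous _ _).ae_le ?_) _
      filter_upwards [Measure.quasiMeasurePreserving_fst.ae hN,
        Measure.quasiMeasurePreserving_snd.ae hP] with p h₁ h₂
      exact ⟨h₁.le, h₂.le⟩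
  have hmix (A : Set ℝ) (hA : MeasurableSet A) :
      μ A = ∫⁻ p : ℝ × ℝ, twoPointMeasure p.1 p.2 A ∂π := by
    have hsplit : μ A = μ {0} * A.indicator 1 0 + (N A + P A) := by
      have hμ : μ = μ.restrict {0} + (N + P) := by
        rw [hN_def, hP_def, ← Measure.restrict_union (by simp) measurableSet_Ioi,
          Set.Iio_union_Ioi, Measure.restrict_add_restrict_compl (measurableSet_singleton 0)]
      conv_lhs => rw [hμ]
      simp [Measure.restrict_singleton, Measure.dirac_apply' _ hA]
    rw [hsplit, hπ_def, lintegral_add_measure, lintegral_smul_measure, lintegral_smul_measure,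
      lintegral_dirac, lintegral_twoPointMeasure_withDensity_prod hN hP hA, hNm, ← hm_def]
    have hzero : twoPointMeasure 0 0 A = A.indicator 1 0 := by
      simp [twoPointMeasure, Measure.dirac_apply' _ hA]
    rw [hzero, smul_eq_mul, smul_eq_mul]
    congr 1
    by_cases h : m = 0
    · simp [hN0 h, hP0 h]
    · rw [mul_comm (N A), ← mul_add, ← mul_assoc, ENNReal.inv_mul_cancel h hm_top, one_mul]
  refine ⟨π, ⟨?_⟩, hsupp, hmix⟩
  have htotal := hmix Set.univ MeasurableSet.univ
  rw [lintegral_congr_ae (hsupp.mono fun p hp => twoPointMeasure_univ hp.1 hp.2),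
    measure_univ, lintegral_one] at htotal
  exact htotal.symm
end
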